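/- Let G be a finite simple graph, λ ≠ 0, and p(n) = det(λ·Id + diag(n)·A_G). If G contains an induced odd cycle on vertices v_1, …, v_m (m odd), then the coefficient of the monomial n_{v_1}···n_{v_m} in p is nonzero. Consequently, if p is an even function of n then G is bipartite. -/

import Mathlib

open Matrix in
/-- The adjacency matrix of a cycle of odd length at least three is nonsingular. -/
theorem det_ne_zero_of_odd_cycle {m : ℕ} (hm : Odd m) (h3 : 3 ≤ m)
    (B : Matrix (Fin m) (Fin m) ℝ)
    (hB : ∀ i j, B i j = if (i.val + 1) % m = j.val ∨ (j.val + 1) % m = i.val then 1 else 0) :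
    B.det ≠ 0 := by
  intro hdet
  obtain ⟨x, hx0, hx⟩ := Matrix.exists_mulVec_eq_zero_iff.2 hdet
  have hpos : 0 < m := by omega
  have hmod (k : ℕ) : k % m < m := Nat.mod_lt k hpos
  let y : ℕ → ℝ := fun k => x ⟨k % m, hmod k⟩
  have hstep (k : ℕ) : y (k + 2) = -y k := by
    have hrow := congrFun hx ⟨(k + 1) % m, hmod _⟩
    have hne : (⟨k % m, hmod k⟩ : Fin m) ≠ ⟨(k + 2) % m, hmod _⟩ := by
      intro h
      have h' : k ≡ k + 2 [MOD m] := congrArg Fin.val h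
      have hdvd := (Nat.modEq_iff_dvd' (by omega)).1 h'
      have := Nat.le_of_dvd (by omega) hdvd
      omega
    have hsupp (j : Fin m) : (((k + 1) % m + 1) % m = j.val ∨ (j.val + 1) % m = (k + 1) % m) ↔
        (j = ⟨k % m, hmod k⟩ ∨ j = ⟨(k + 2) % m, hmod _⟩) := by
      rw [or_comm]
      simp only [Fin.ext_iff]
      have h1 : ((k + 1) % m + 1) % m = (k + 2) % m := by simp [Nat.add_assoc]
      have h2 : (j.val + 1) % m = (k + 1) % m ↔ j.val = k % m := by
        constructor
        · intro h
          have h' : j.val ≡ k [MOD m] := Nat.ModEq.add_right_cancel' 1 h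
          rw [← Nat.mod_eq_of_lt j.isLt]
          exact h'
        · intro h
          simp [h]
      rw [h1, h2, eq_comm (a := (k + 2) % m)]
    have hsum : ∑ j, B ⟨(k + 1) % m, hmod _⟩ j * x j = y k + y (k + 2) := by
      simp only [hB, hsupp, ite_mul, one_mul, zero_mul]
      rw [← Finset.sum_filter, Finset.filter_or, Finset.sum_union]
      · simp [Finset.filter_eq', y]
      · simpa [Finset.filter_eq'] using fun h => hne (Fin.ext h)
    simp only [mulVec, dotProduct, hsum, Pi.zero_apply] at hrow
    linarith
  have hiter (k n : ℕ) : y (k + 2 * n) = (-1) ^ n * y k := by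
    induction n with
    | zero => simp
    | succ n ih => rw [Nat.mul_succ, ← Nat.add_assoc, hstep, ih, pow_succ]; ring
  apply hx0
  ext i
  have h := hiter i m
  have hper : y (i + 2 * m) = y i := by simp [y]
  have hi : y i = x i := by simp [y, Nat.mod_eq_of_lt i.isLt]
  rw [hper, hm.neg_one_pow, hi] at h
  simp only [Pi.zero_apply]
  linarith

/-- A graph that is not two-colorable contains an induced odd cycle. -/
theorem SimpleGraph.exists_induced_odd_cycle {V : Type*} {G : SimpleGraph V}
    (hG : ¬ G.Colorable 2) :
    ∃ m : ℕ, Odd m ∧ 3 ≤ m ∧ ∃ c : Fin m → V, Function.Injective c ∧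
      ∀ i j : Fin m, G.Adj (c i) (c j) ↔
        ((i.val + 1) % m = j.val ∨ (j.val + 1) % m = i.val) := by
  classical
  have hex : ∃ m : ℕ, Odd m ∧ ∃ (u : V) (w : G.Walk u u), w.length = m := by
    by_contra! h
    apply hG
    rw [SimpleGraph.two_colorable_iff_forall_loop_even]
    intro u w
    by_contra hw
    exact h w.length (Nat.not_even_iff_odd.1 hw) u w rfl
  obtain ⟨hodd, u, w, hw⟩ := Nat.find_spec hex
  have hmin {n : ℕ} (hn : n < Nat.find hex) (hno : Odd n) (v : V) (p : G.Walk v v) :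
      p.length ≠ n := fun h => Nat.find_min hex hn ⟨hno, v, p, h⟩
  generalize Nat.find hex = m at hodd hw hmin
  have h3 : 3 ≤ m := by
    have h1 : m ≠ 1 := fun h => G.irrefl (SimpleGraph.Walk.adj_of_length_eq_one (hw.trans h))
    obtain ⟨k, rfl⟩ := hodd
    omega
  have hadj (i : ℕ) (hi : i < m) : G.Adj (w.getVert i) (w.getVert (i + 1)) :=
    w.adj_getVert_succ (by omega)
  have hm0 : w.getVert m = w.getVert 0 := by simp [← hw]
  have harc (i d : ℕ) (hd : i + d ≤ m) :
      ∃ p : G.Walk (w.getVert i) (w.getVert (i + d)), p.length = d := by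
    induction d with
    | zero => exact ⟨.nil, rfl⟩
    | succ d ih =>
      obtain ⟨p, hp⟩ := ih (by omega)
      exact ⟨p.concat (hadj (i + d) (by omega)), by simp [hp]⟩
  have hcoarc (i d : ℕ) (hd : i + d ≤ m) :
      ∃ p : G.Walk (w.getVert (i + d)) (w.getVert i), p.length = m - d := by
    obtain ⟨p, hp⟩ := harc (i + d) (m - (i + d)) (by omega)
    obtain ⟨q, hq⟩ := harc 0 i (by omega)
    refine ⟨(p.copy rfl (by rw [Nat.add_sub_cancel' hd, hm0])).append
      (q.copy rfl (by rw [Nat.zero_add])), ?_⟩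
    simp only [SimpleGraph.Walk.length_append, SimpleGraph.Walk.length_copy, hp, hq]
    omega
  have hne (i d : ℕ) (hd0 : 0 < d) (hd : i + d < m) : w.getVert i ≠ w.getVert (i + d) := by
    intro h
    obtain ⟨p, hp⟩ := harc i d hd.le
    obtain ⟨q, hq⟩ := hcoarc i d hd.le
    rcases Nat.even_or_odd d with he | ho
    · exact hmin (n := m - d) (by omega) (Nat.Odd.sub_even (by omega) hodd he) _
        (q.copy rfl h) (by simp [hq])
    · exact hmin (by omega) ho _ (p.copy rfl h.symm) (by simp [hp])
  have hchord (i d : ℕ) (hd0 : 0 < d) (hd : i + d < m)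
      (h : G.Adj (w.getVert i) (w.getVert (i + d))) : d = 1 ∨ d + 1 = m := by
    obtain ⟨p, hp⟩ := harc i d hd.le
    obtain ⟨q, hq⟩ := hcoarc i d hd.le
    by_contra! hcon
    rcases Nat.even_or_odd d with he | ho
    · exact hmin (n := d + 1) (by omega) he.add_one _ (p.concat h.symm) (by simp [hp])
    · exact hmin (n := m - d + 1) (by omega) (Nat.Odd.sub_odd hodd ho).add_one _ (q.concat h)
        (by simp [hq])
  have hiff (i j : ℕ) (hij : i < j) (hj : j < m) :
      G.Adj (w.getVert i) (w.getVert j) ↔ ((i + 1) % m = j ∨ (j + 1) % m = i) := by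
    obtain ⟨d, rfl⟩ := Nat.exists_eq_add_of_lt hij
    rw [Nat.mod_eq_of_lt (a := i + 1) (by omega)]
    constructor
    · intro h
      rcases hchord i (d + 1) (by omega) hj h with h1 | h1
      · left; omega
      · right
        have : i + d + 1 + 1 = m := by omega
        rw [this, Nat.mod_self]
        omega
    · rintro (h | h)
      · exact h ▸ hadj i (by omega)
      · rcases Nat.lt_or_ge (i + d + 1 + 1) m with hlt | hge
        · rw [Nat.mod_eq_of_lt hlt] at h
          omega
        · have hlast : i + d + 1 + 1 = m := by omega
          rw [hlast, Nat.mod_self] at h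
          have := hadj (i + d + 1) hj
          rw [hlast, hm0, h] at this
          exact this.symm
  refine ⟨m, hodd, h3, fun i => w.getVert i, ?_, ?_⟩
  · intro i j h
    by_contra hij
    rcases Nat.lt_or_gt_of_ne (Fin.val_ne_of_ne hij) with hlt | hlt
    · apply hne i (j - i) (by omega) (by omega)
      rw [Nat.add_sub_cancel' hlt.le]
      exact h
    · apply hne j (i - j) (by omega) (by omega)
      rw [Nat.add_sub_cancel' hlt.le]
      exact h.symm
  · intro i j
    rcases Nat.lt_trichotomy i.val j.val with hlt | heq | hlt
    · exact hiff i j hlt j.isLt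
    · simp only [heq, SimpleGraph.irrefl, or_self, false_iff]
      rcases Nat.lt_or_ge (j.val + 1) m with h | h
      · rw [Nat.mod_eq_of_lt h]
        omega
      · have hlast : j.val + 1 = m := by omega
        rw [hlast, Nat.mod_self]
        omega
    · rw [SimpleGraph.adj_comm, or_comm]
      exact hiff j i hlt i.isLt

open Matrix in
/-- Weighting the rows of `A` by a multiple of the multiplicity function of `c : ι → V` localizes
the determinant to the submatrix of `A` along `c`. -/
theorem Matrix.det_smul_one_add_diagonal_mul {V ι K : Type*} [Fintype V] [DecidableEq V]
    [Fintype ι] [DecidableEq ι] [Field K] (A : Matrix V V K) (c : ι → V) (a t : K) :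
    (a • (1 : Matrix V V K) +
        diagonal (fun v => a * t * ∑ i, if v = c i then (1 : K) else 0) * A).det =
      a ^ Fintype.card V * (1 + t • A.submatrix c c).det := by
  let C : Matrix V ι K := (1 : Matrix V V K).submatrix id c
  have hdiag : diagonal (fun v => a * t * ∑ i, if v = c i then (1 : K) else 0) =
      a • (C * (t • Cᵀ)) := by
    ext v w
    simp only [C, smul_apply, mul_apply, submatrix_apply, transpose_apply, one_apply, id_eq,
      diagonal_apply, smul_eq_mul]
    rcases eq_or_ne v w with rfl | hvw
    · rw [if_pos rfl, mul_assoc, Finset.mul_sum]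
      congr 1
      refine Finset.sum_congr rfl fun i _ => ?_
      split_ifs <;> simp
    · rw [if_neg hvw, Finset.sum_eq_zero, mul_zero]
      intro i _
      split_ifs with h1 h2
      · exact absurd (h1.trans h2.symm) hvw
      · simp
      · simp
      · simp
  have hsub : (t • Cᵀ * A) * C = t • A.submatrix c c := by
    ext i j
    simp [C, mul_apply, one_apply]
  rw [hdiag, smul_mul, ← smul_add, det_smul, Matrix.mul_assoc, det_one_add_mul_comm, hsub]

/-- A square matrix of odd size with `det (1 + t B)` even in `t` is singular. -/
theorem Matrix.det_eq_zero_of_det_one_add_smul_even {ι : Type*} [Fintype ι] [DecidableEq ι]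
    (hodd : Odd (Fintype.card ι)) (B : Matrix ι ι ℝ)
    (h : ∀ t : ℝ, (1 + (-t) • B).det = (1 + t • B).det) : B.det = 0 := by
  have hfun : (fun s : ℝ => (s • (1 : Matrix ι ι ℝ) - B).det) =
      fun s : ℝ => (s • (1 : Matrix ι ι ℝ) + B).det := by
    refine Continuous.ext_on (dense_compl_singleton (0 : ℝ)) (by fun_prop) (by fun_prop) ?_
    intro s hs
    have hs : s ≠ 0 := hs
    have h1 : s • (1 : Matrix ι ι ℝ) - B = s • (1 + (-s⁻¹) • B) := by
      simp [smul_add, smul_smul, hs, sub_eq_add_neg]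
    have h2 : s • (1 : Matrix ι ι ℝ) + B = s • (1 + s⁻¹ • B) := by
      simp [smul_add, smul_smul, hs]
    simp only [h1, h2, Matrix.det_smul, h]
  have h0 := congrFun hfun 0
  simp only [zero_smul, zero_sub, zero_add, Matrix.det_neg, hodd.neg_one_pow] at h0
  linarith


/-- an induced odd cycle gives a nonzero coefficient of odd
degree in the adjacency blowup-polynomial; consequently, if the
blowup-polynomial is even then the graph is bipartite. -/
theorem odd_cycle_coeff_ne_zero_and_even_implies_bipartite
    {V : Type*} [Fintype V] [DecidableEq V]
    (G : SimpleGraph V) [DecidableRel G.Adj]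
    (lam : ℝ) (hlam : lam ≠ 0) :
    (∀ (m : ℕ), Odd m → 3 ≤ m → ∀ c : Fin m → V, Function.Injective c →
        (∀ i j : Fin m, G.Adj (c i) (c j) ↔ ((i.val + 1) % m = j.val ∨ (j.val + 1) % m = i.val)) →
        lam ^ (Fintype.card V - m) * ((G.adjMatrix ℝ).submatrix c c).det ≠ 0) ∧
    ((∀ n : V → ℝ,
        (lam • (1 : Matrix V V ℝ) + Matrix.diagonal (-n) * G.adjMatrix ℝ).det
          = (lam • (1 : Matrix V V ℝ) + Matrix.diagonal n * G.adjMatrix ℝ).det)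
      → G.Colorable 2) := by
  have hdet (m : ℕ) (hm : Odd m) (h3 : 3 ≤ m) (c : Fin m → V)
      (hc : ∀ i j : Fin m, G.Adj (c i) (c j) ↔
        ((i.val + 1) % m = j.val ∨ (j.val + 1) % m = i.val)) :
      ((G.adjMatrix ℝ).submatrix c c).det ≠ 0 :=
    det_ne_zero_of_odd_cycle hm h3 _ fun i j => by
      simp [SimpleGraph.adjMatrix_apply, hc]
  refine ⟨fun m hm h3 c _ hc => mul_ne_zero (pow_ne_zero _ hlam) (hdet m hm h3 c hc), ?_⟩
  intro heven
  by_contra hG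
  obtain ⟨m, hm, h3, c, -, hc⟩ := SimpleGraph.exists_induced_odd_cycle hG
  refine hdet m hm h3 c hc (Matrix.det_eq_zero_of_det_one_add_smul_even (by simpa using hm) _ ?_)
  intro t
  have hneg : -(fun v => lam * t * ∑ i, if v = c i then (1 : ℝ) else 0) =
      fun v => lam * (-t) * ∑ i, if v = c i then (1 : ℝ) else 0 := by
    ext v
    simp
  have h := heven (fun v => lam * t * ∑ i, if v = c i then (1 : ℝ) else 0)
  rw [hneg, Matrix.det_smul_one_add_diagonal_mul, Matrix.det_smul_one_add_diagonal_mul] at h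
  exact mul_left_cancel₀ (pow_ne_zero _ hlam) h
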